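/- arXiv:2304.02402 — 2 statements merged into one kernel-verified Lean document; each statement's English description precedes it below -/
import Mathlib

section
/- Let μ and ν be probability measures on S¹ with μ absolutely continuous, and let θ* ∈ ℝ be a minimizer of θ ↦ C_{[μ,ν]}(θ). Define T̃(x) := F_ν̃⁻(F_μ̃(x) − θ*) and T := exp_c ∘ T̃ ∘ log_c. Then T # μ = ν, ∫_{S¹} d_R(z, T(z))² dμ(z) = W₂²(μ, ν) (so T is an optimal transport map from μ to ν), and W₂²(μ,ν) = C_{[μ,ν]}(θ*) = min_{θ ∈ ℝ} C_{[μ,ν]}(θ). -/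
open MeasureTheory Real Set Filter Topology

noncomputable section

instance : Fact (0 < 2 * Real.pi) := ⟨by positivity⟩

/-- The circle `ℝ / 2πℤ`. -/
abbrev S1 : Type := AddCircle (2 * Real.pi)

/-- The quotient projection `exp_c : ℝ → S¹`. -/
def expc (x : ℝ) : S1 := (x : S1)

/-- The canonical right inverse `log_c : S¹ → [0, 2π)`. -/
def logc (z : S1) : ℝ := (AddCircle.equivIco (2 * Real.pi) 0 z : ℝ)

/-- Squared 2-Wasserstein distance: infimum of `∫ d(x,y)² dγ` over couplings `γ`. -/
def W2sq {X : Type*} [MeasurableSpace X] [PseudoMetricSpace X]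
    (μ ν : Measure X) : ℝ :=
  sInf { c : ℝ | ∃ γ : Measure (X × X), IsProbabilityMeasure γ ∧
      γ.map Prod.fst = μ ∧ γ.map Prod.snd = ν ∧
      c = ∫ p, dist p.1 p.2 ^ 2 ∂γ }

/-- `T` is an optimal transport map from `μ` to `ν`. -/
def IsOTM (μ ν : Measure S1) (T : S1 → S1) : Prop :=
  Measurable T ∧ μ.map T = ν ∧ (∫ z, dist z (T z) ^ 2 ∂μ) = W2sq μ ν

/-- `μ̃`, the pushforward of a measure on `S¹` to `[0, 2π) ⊆ ℝ` via `log_c`. -/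
def tilde (μ : Measure S1) : Measure ℝ := μ.map logc

/-- The periodic cumulative distribution function of a (periodicised) measure on `[0,2π)`:
`F(x) = μ̃([0,x))` for `x ∈ [0,2π]`, extended by `F(x + 2π) = F(x) + 1`. -/
def cdf (μt : Measure ℝ) (x : ℝ) : ℝ :=
  ⌊x / (2 * π)⌋ + (μt (Set.Ico 0 (Int.fract (x / (2 * π)) * (2 * π)))).toReal

/-- The quantile function (generalized inverse) of the periodic cdf. -/
def qf (μt : Measure ℝ) (u : ℝ) : ℝ := sInf { x : ℝ | u ≤ cdf μt x }

/-- The cost `C_{[μ,ν]}(θ) = ∫₀¹ (F_μ̃⁻(u) − F_ν̃⁻(u−θ))² du`. -/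
def cost (μ ν : Measure S1) (θ : ℝ) : ℝ :=
  ∫ u in (0:ℝ)..1, (qf (tilde μ) u - qf (tilde ν) (u - θ)) ^ 2


/-- The mean of `⌊s + a⌋` over a unit interval is `a`. -/
lemma integral_floor_add (a : ℝ) : ∫ s in (0:ℝ)..1, ((⌊s + a⌋ : ℤ) : ℝ) = a := by
  have hper : Function.Periodic (Int.fract : ℝ → ℝ) 1 := fun x => by simp
  have h1 : ∫ s in (0:ℝ)..1, Int.fract (s + a) = 1 / 2 := by
    rw [intervalIntegral.integral_comp_add_right (fun s => Int.fract s) a, zero_add, add_comm 1 a,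
      hper.intervalIntegral_add_eq a 0, zero_add]
    have : ∫ s in (0:ℝ)..1, Int.fract s = ∫ s in (0:ℝ)..1, s := by
      refine intervalIntegral.integral_congr_Ioo_of_le zero_le_one fun s hs => ?_
      exact Int.fract_eq_self.2 ⟨hs.1.le, hs.2⟩
    rw [this, integral_id]; norm_num
  have hi : IntervalIntegrable (fun s => Int.fract (s + a)) volume 0 1 := by
    rw [intervalIntegrable_iff]
    refine Measure.integrableOn_of_bounded (M := 1) (by simp)
      (measurable_fract.comp (measurable_id.add_const a)).aestronglyMeasurable ?_
    refine ae_of_all _ fun s => ?_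
    rw [Real.norm_eq_abs, abs_of_nonneg (Int.fract_nonneg _)]
    exact (Int.fract_lt_one _).le
  have h2 : ∀ s : ℝ, ((⌊s + a⌋ : ℤ) : ℝ) = (s + a) - Int.fract (s + a) := fun s => by
    linarith [Int.floor_add_fract (s + a)]
  simp_rw [h2]
  have hs : Continuous fun s : ℝ => s + a := by fun_prop
  rw [intervalIntegral.integral_sub (hs.intervalIntegrable 0 1) hi, h1,
    intervalIntegral.integral_comp_add_right (fun s => s) a, integral_id]
  ring

lemma integrableOn_floor_add (a : ℝ) :
    IntegrableOn (fun s : ℝ => ((⌊s + a⌋ : ℤ) : ℝ)) (Ioc 0 1) := by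
  have hm : Monotone fun s : ℝ => ((⌊s + a⌋ : ℤ) : ℝ) := fun x y h =>
    Int.cast_le.2 (Int.floor_le_floor (by linarith))
  have := (hm.intervalIntegrable (μ := volume) (a := 0) (b := 1))
  rwa [intervalIntegrable_iff, uIoc_of_le zero_le_one] at this

/-- The positive part of `⌊s + a⌋ - ⌊s + b⌋`, averaged over a unit interval, is that of `a - b`. -/
lemma lintegral_floor_add_sub (a b : ℝ) :
    ∫⁻ s in Ioc (0:ℝ) 1, ENNReal.ofReal (((⌊s + a⌋ : ℤ) : ℝ) - ((⌊s + b⌋ : ℤ) : ℝ))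
      = ENNReal.ofReal (a - b) := by
  rcases le_total a b with h | h
  · rw [ENNReal.ofReal_of_nonpos (by linarith), lintegral_eq_zero_of_ae_eq_zero]
    refine ae_of_all _ fun s => ENNReal.ofReal_of_nonpos ?_
    exact sub_nonpos.2 (Int.cast_le.2 (Int.floor_le_floor (by linarith)))
  · have hi : IntegrableOn (fun s : ℝ => ((⌊s + a⌋ : ℤ) : ℝ) - ((⌊s + b⌋ : ℤ) : ℝ)) (Ioc 0 1) :=
      (integrableOn_floor_add a).sub (integrableOn_floor_add b)
    rw [← ofReal_integral_eq_lintegral_ofReal hi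
      (ae_of_all _ fun s => sub_nonneg.2 (Int.cast_le.2 (Int.floor_le_floor (by linarith)))),
      integral_sub (integrableOn_floor_add a) (integrableOn_floor_add b),
      ← intervalIntegral.integral_of_le zero_le_one, ← intervalIntegral.integral_of_le zero_le_one,
      integral_floor_add, integral_floor_add]

lemma lintegral_floor_sub_sub (a b : ℝ) :
    ∫⁻ u in Ioc (0:ℝ) 1, ENNReal.ofReal (((⌊a - u⌋ : ℤ) : ℝ) - ((⌊b - u⌋ : ℤ) : ℝ))
      = ENNReal.ofReal (a - b) := by
  have hmp : MeasurePreserving (fun u : ℝ => 1 - u) volume volume :=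
    Measure.measurePreserving_sub_left volume 1
  have he : MeasurableEmbedding (fun u : ℝ => 1 - u) :=
    (Homeomorph.subLeft (1:ℝ)).measurableEmbedding
  have hpre : (fun u : ℝ => 1 - u) ⁻¹' Ico 0 1 = Ioc 0 1 := by
    ext u; simp
  have := hmp.setLIntegral_comp_preimage_emb he (fun s => ENNReal.ofReal
    (((⌊s + (a - 1)⌋ : ℤ) : ℝ) - ((⌊s + (b - 1)⌋ : ℤ) : ℝ))) (Ico 0 1)
  rw [hpre, setLIntegral_congr Ico_ae_eq_Ioc, lintegral_floor_add_sub] at this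
  have h1 : ∀ u c : ℝ, 1 - u + (c - 1) = c - u := fun u c => by ring
  simp_rw [h1] at this
  rw [this]
  congr 1
  ring

lemma lintegral_Ioi_ofReal_sub (d : ℝ) :
    ∫⁻ h in Ioi (0:ℝ), ENNReal.ofReal (d - h) = ENNReal.ofReal ((max d 0) ^ 2 / 2) := by
  rcases le_total d 0 with hd | hd
  · rw [max_eq_right hd, setLIntegral_congr_fun (g := 0) measurableSet_Ioi]
    · simp
    · intro h hh
      exact ENNReal.ofReal_of_nonpos (by linarith [mem_Ioi.1 hh])
  · rw [max_eq_left hd, ← Ioc_union_Ioi_eq_Ioi hd,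
      lintegral_union measurableSet_Ioi (Ioc_disjoint_Ioi le_rfl),
      setLIntegral_congr_fun (g := 0) (s := Ioi d) measurableSet_Ioi
        (fun h hh => ENNReal.ofReal_of_nonpos (by linarith [mem_Ioi.1 hh])),
      ← ofReal_integral_eq_lintegral_ofReal, ← intervalIntegral.integral_of_le hd,
      intervalIntegral.integral_sub (by simp) (by simp)]
    · simp
      ring_nf
    · exact (continuous_const.sub continuous_id).integrableOn_Ioc
    · filter_upwards [ae_restrict_mem measurableSet_Ioc] with h hh
      exact sub_nonneg.2 hh.2

/-- A square as an integral of hinge functions. -/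
lemma ofReal_sq_eq_lintegral_hinge (d : ℝ) :
    ENNReal.ofReal (d ^ 2) =
      2 * ((∫⁻ h in Ioi (0:ℝ), ENNReal.ofReal (d - h)) +
        ∫⁻ h in Ioi (0:ℝ), ENNReal.ofReal (-d - h)) := by
  rw [lintegral_Ioi_ofReal_sub, lintegral_Ioi_ofReal_sub, ← ENNReal.ofReal_add (by positivity)
    (by positivity), ← ENNReal.ofReal_ofNat, ← ENNReal.ofReal_mul (by norm_num)]
  congr 1
  rcases le_total d 0 with hd | hd
  · rw [max_eq_right hd, max_eq_left (by linarith)]; ring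
  · rw [max_eq_left hd, max_eq_right (by linarith)]; ring

section Comparison

variable {Ω : Type*} [MeasurableSpace Ω]

lemma measurable_floor_sub_div {X : Ω → ℝ} (hX : Measurable X) {s : Ω → ℝ} (hs : Measurable s)
    (p : ℝ) : Measurable fun ω => ((⌊(s ω - X ω) / p⌋ : ℤ) : ℝ) :=
  measurable_from_top.comp (((hs.sub hX).div_const p).floor)

/-- Averaging over the position of the cut turns a hinge of the displacement into a winding count. -/
lemma lintegral_hinge_eq (P : Measure Ω) [SFinite P] {X Y : Ω → ℝ} (hX : Measurable X)
    (hY : Measurable Y) {p : ℝ} (hp : 0 < p) (h : ℝ) :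
    ∫⁻ ω, ENNReal.ofReal (Y ω - X ω - h) ∂P =
      ENNReal.ofReal p * ∫⁻ s in Ioc (0:ℝ) 1, ∫⁻ ω, ENNReal.ofReal
        (((⌊(p * s - X ω) / p⌋ : ℤ) : ℝ) - ((⌊(p * s + h - Y ω) / p⌋ : ℤ) : ℝ)) ∂P := by
  rw [lintegral_lintegral_swap, ← lintegral_const_mul']
  · refine lintegral_congr fun ω => ?_
    have h1 : ∀ s, (p * s - X ω) / p = s + (- X ω / p) := fun s => by field_simp; ring
    have h2 : ∀ s, (p * s + h - Y ω) / p = s + (h - Y ω) / p := fun s => by field_simp; ring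
    simp_rw [h1, h2]
    rw [lintegral_floor_add_sub, ← ENNReal.ofReal_mul hp.le]
    congr 1
    field_simp
    ring
  · exact ENNReal.ofReal_ne_top
  · refine Measurable.aemeasurable (Measurable.ennreal_ofReal (Measurable.sub ?_ ?_))
    · exact measurable_floor_sub_div (hX.comp measurable_snd) (measurable_fst.const_mul p) p
    · exact measurable_floor_sub_div (hY.comp measurable_snd)
        ((measurable_fst.const_mul p).add_const h) p

lemma ofReal_integral_le_lintegral {P : Measure Ω} {f : Ω → ℝ} (hf : Integrable f P) :
    ENNReal.ofReal (∫ ω, f ω ∂P) ≤ ∫⁻ ω, ENNReal.ofReal (f ω) ∂P := by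
  calc ENNReal.ofReal (∫ ω, f ω ∂P) ≤ ENNReal.ofReal (∫ ω, max (f ω) 0 ∂P) :=
        ENNReal.ofReal_le_ofReal (integral_mono hf hf.pos_part fun ω => le_max_left _ _)
    _ = ∫⁻ ω, ENNReal.ofReal (max (f ω) 0) ∂P :=
        ofReal_integral_eq_lintegral_ofReal hf.pos_part (ae_of_all _ fun ω => le_max_right _ _)
    _ = ∫⁻ ω, ENNReal.ofReal (f ω) ∂P := by simp

lemma lintegral_hinge_le (P : Measure Ω) [IsProbabilityMeasure P] {X Y : Ω → ℝ}
    (hX : Measurable X) (hY : Measurable Y) {p : ℝ} (hp : 0 < p) {a b : ℝ → ℝ}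
    (hXi : ∀ s, Integrable (fun ω => ((⌊(s - X ω) / p⌋ : ℤ) : ℝ)) P)
    (hYi : ∀ s, Integrable (fun ω => ((⌊(s - Y ω) / p⌋ : ℤ) : ℝ)) P)
    (ha : ∀ s, ∫ ω, ((⌊(s - X ω) / p⌋ : ℤ) : ℝ) ∂P = a s - 1)
    (hb : ∀ s, ∫ ω, ((⌊(s - Y ω) / p⌋ : ℤ) : ℝ) ∂P = b s - 1)
    {X' Y' : ℝ → ℝ} (hX' : Measurable X') (hY' : Measurable Y')
    (ha' : ∀ s u, ⌊(s - X' u) / p⌋ = ⌊a s - u⌋) (hb' : ∀ s u, ⌊(s - Y' u) / p⌋ = ⌊b s - u⌋)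
    (h : ℝ) :
    ∫⁻ u in Ioc (0:ℝ) 1, ENNReal.ofReal (Y' u - X' u - h) ≤
      ∫⁻ ω, ENNReal.ofReal (Y ω - X ω - h) ∂P := by
  rw [lintegral_hinge_eq _ hX' hY' hp, lintegral_hinge_eq _ hX hY hp]
  gcongr with s
  simp_rw [ha', hb']
  rw [lintegral_floor_sub_sub]
  calc ENNReal.ofReal (a (p * s) - b (p * s + h))
      = ENNReal.ofReal (∫ ω, (((⌊(p * s - X ω) / p⌋ : ℤ) : ℝ) -
          ((⌊(p * s + h - Y ω) / p⌋ : ℤ) : ℝ)) ∂P) := by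
        rw [integral_sub (hXi _) (hYi _), ha, hb]; congr 1; ring
    _ ≤ _ := ofReal_integral_le_lintegral ((hXi _).sub (hYi _))

lemma lintegral_sq_eq_hinge (P : Measure Ω) [SFinite P] {X Y : Ω → ℝ} (hX : Measurable X)
    (hY : Measurable Y) :
    ∫⁻ ω, ENNReal.ofReal ((X ω - Y ω) ^ 2) ∂P =
      2 * ((∫⁻ h in Ioi (0:ℝ), ∫⁻ ω, ENNReal.ofReal (X ω - Y ω - h) ∂P) +
        ∫⁻ h in Ioi (0:ℝ), ∫⁻ ω, ENNReal.ofReal (Y ω - X ω - h) ∂P) := by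
  have hm : ∀ {A B : Ω → ℝ}, Measurable A → Measurable B →
      Measurable fun q : ℝ × Ω => ENNReal.ofReal (A q.2 - B q.2 - q.1) := fun hA hB =>
    (((hA.comp measurable_snd).sub (hB.comp measurable_snd)).sub measurable_fst).ennreal_ofReal
  rw [lintegral_lintegral_swap (f := fun h ω => ENNReal.ofReal (X ω - Y ω - h))
      (hm hX hY).aemeasurable,
    lintegral_lintegral_swap (f := fun h ω => ENNReal.ofReal (Y ω - X ω - h))
      (hm hY hX).aemeasurable,
    ← lintegral_add_left, ← lintegral_const_mul]
  · refine lintegral_congr fun ω => ?_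
    rw [ofReal_sq_eq_lintegral_hinge, neg_sub]
  · exact ((hm hX hY).lintegral_prod_left').add (hm hY hX).lintegral_prod_left'
  · exact (hm hX hY).lintegral_prod_left'

/-- Among couplings with prescribed mean winding counts, the monotone one has least quadratic
cost. -/
lemma lintegral_sq_le (P : Measure Ω) [IsProbabilityMeasure P] {X Y : Ω → ℝ}
    (hX : Measurable X) (hY : Measurable Y) {p : ℝ} (hp : 0 < p) {a b : ℝ → ℝ}
    (hXi : ∀ s, Integrable (fun ω => ((⌊(s - X ω) / p⌋ : ℤ) : ℝ)) P)
    (hYi : ∀ s, Integrable (fun ω => ((⌊(s - Y ω) / p⌋ : ℤ) : ℝ)) P)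
    (ha : ∀ s, ∫ ω, ((⌊(s - X ω) / p⌋ : ℤ) : ℝ) ∂P = a s - 1)
    (hb : ∀ s, ∫ ω, ((⌊(s - Y ω) / p⌋ : ℤ) : ℝ) ∂P = b s - 1)
    {X' Y' : ℝ → ℝ} (hX' : Measurable X') (hY' : Measurable Y')
    (ha' : ∀ s u, ⌊(s - X' u) / p⌋ = ⌊a s - u⌋) (hb' : ∀ s u, ⌊(s - Y' u) / p⌋ = ⌊b s - u⌋) :
    ∫⁻ u in Ioc (0:ℝ) 1, ENNReal.ofReal ((X' u - Y' u) ^ 2) ≤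
      ∫⁻ ω, ENNReal.ofReal ((X ω - Y ω) ^ 2) ∂P := by
  rw [lintegral_sq_eq_hinge _ hX' hY', lintegral_sq_eq_hinge _ hX hY]
  gcongr with h h
  · exact lintegral_hinge_le P hY hX hp hYi hXi hb ha hY' hX' hb' ha' h
  · exact lintegral_hinge_le P hX hY hp hXi hYi ha hb hX' hY' ha' hb' h

end Comparison

lemma abs_floor_le (v : ℝ) : |((⌊v⌋ : ℤ) : ℝ)| ≤ |v| + 1 := by
  have h1 := Int.floor_le v
  have h2 := Int.lt_floor_add_one v
  rw [abs_le]
  constructor <;> linarith [neg_abs_le v, le_abs_self v]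

lemma integrable_floor_sub_div {Ω : Type*} [MeasurableSpace Ω] {P : Measure Ω} [IsFiniteMeasure P]
    {X : Ω → ℝ} (hX : Measurable X) (hXi : Integrable X P) (s p : ℝ) :
    Integrable (fun ω => ((⌊(s - X ω) / p⌋ : ℤ) : ℝ)) P := by
  refine Integrable.mono' (g := fun ω => |(s - X ω) / p| + 1) ?_
    (measurable_from_top.comp (((measurable_const.sub hX).div_const p).floor)).aestronglyMeasurable
    (ae_of_all _ fun ω => abs_floor_le _)
  exact ((((integrable_const s).sub hXi).div_const p).abs).add (integrable_const 1)

lemma cdf_add_int_mul (m : Measure ℝ) (x : ℝ) (k : ℤ) : cdf m (x + k * (2 * π)) = cdf m x + k := by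
  have h : (x + k * (2 * π)) / (2 * π) = x / (2 * π) + k := by
    have := two_pi_pos
    field_simp
  simp only [cdf, h, Int.floor_add_intCast, Int.fract_add_intCast]
  push_cast
  ring

lemma cdf_zero (m : Measure ℝ) : cdf m 0 = 0 := by simp [cdf]

lemma cdf_int_mul (m : Measure ℝ) (k : ℤ) : cdf m (k * (2 * π)) = k := by
  simpa [cdf_zero] using cdf_add_int_mul m 0 k

/-- The right-continuous periodic cdf of a measure on `[0, 2π)`, as a mean winding count. -/
def rcdf (m : Measure ℝ) (x : ℝ) : ℝ := ∫ a, ((⌊(x - a) / (2 * π)⌋ : ℤ) : ℝ) ∂m + 1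

section Quantile

variable {m : Measure ℝ} [IsProbabilityMeasure m]

lemma integrable_id_of_mem_Ico (hm : ∀ᵐ a ∂m, a ∈ Ico 0 (2 * π)) : Integrable (fun a : ℝ => a) m :=
  Integrable.of_bound measurable_id.aestronglyMeasurable (2 * π) <| by
    filter_upwards [hm] with a ha
    rw [Real.norm_eq_abs, abs_of_nonneg ha.1]
    exact ha.2.le

lemma integrable_floor_of_mem_Ico (hm : ∀ᵐ a ∂m, a ∈ Ico 0 (2 * π)) (x : ℝ) :
    Integrable (fun a => ((⌊(x - a) / (2 * π)⌋ : ℤ) : ℝ)) m :=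
  integrable_floor_sub_div measurable_id (integrable_id_of_mem_Ico hm) x _

lemma ceil_sub_div_eq (x : ℝ) {a : ℝ} (ha : a ∈ Ico 0 (2 * π)) :
    ((⌈(x - a) / (2 * π)⌉ : ℤ) : ℝ) = ⌊x / (2 * π)⌋ +
      (Ico 0 (Int.fract (x / (2 * π)) * (2 * π))).indicator (fun _ => (1:ℝ)) a := by
  have hp := two_pi_pos
  have hx := Int.floor_add_fract (x / (2 * π))
  have h1 : (x - a) / (2 * π) =
      (Int.fract (x / (2 * π)) - a / (2 * π)) + (⌊x / (2 * π)⌋ : ℤ) := by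
    rw [sub_div]; linarith
  have hf0 := Int.fract_nonneg (x / (2 * π))
  have hf1 := Int.fract_lt_one (x / (2 * π))
  have ha0 : 0 ≤ a / (2 * π) := div_nonneg ha.1 hp.le
  have ha1 : a / (2 * π) < 1 := (div_lt_one hp).2 ha.2
  rw [h1, Int.ceil_add_intCast, Int.cast_add, add_comm]
  congr 1
  by_cases h : a < Int.fract (x / (2 * π)) * (2 * π)
  · have h' : a / (2 * π) < Int.fract (x / (2 * π)) := (div_lt_iff₀ hp).2 h
    rw [indicator_of_mem (show a ∈ Ico _ _ from ⟨ha.1, h⟩)]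
    have : ⌈Int.fract (x / (2 * π)) - a / (2 * π)⌉ = 1 := by
      rw [Int.ceil_eq_iff]; push_cast; constructor <;> linarith
    simp [this]
  · have h' : Int.fract (x / (2 * π)) ≤ a / (2 * π) := (le_div_iff₀ hp).2 (not_lt.1 h)
    rw [indicator_of_notMem fun hh : a ∈ Ico _ _ => h hh.2]
    have : ⌈Int.fract (x / (2 * π)) - a / (2 * π)⌉ = 0 := by
      rw [Int.ceil_eq_iff]; push_cast; constructor <;> linarith
    simp [this]

lemma cdf_eq_integral_ceil (hm : ∀ᵐ a ∂m, a ∈ Ico 0 (2 * π)) (x : ℝ) :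
    cdf m x = ∫ a, ((⌈(x - a) / (2 * π)⌉ : ℤ) : ℝ) ∂m := by
  have h : (fun a => ((⌈(x - a) / (2 * π)⌉ : ℤ) : ℝ)) =ᵐ[m] fun a => (⌊x / (2 * π)⌋ : ℝ) +
      (Ico 0 (Int.fract (x / (2 * π)) * (2 * π))).indicator (fun _ => (1:ℝ)) a := by
    filter_upwards [hm] with a ha using ceil_sub_div_eq x ha
  rw [integral_congr_ae h, integral_add (integrable_const _)
    ((integrable_const _).indicator measurableSet_Ico), integral_indicator measurableSet_Ico]
  simp [cdf, Measure.real]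

lemma tendsto_integral_floor (hm : ∀ᵐ a ∂m, a ∈ Ico 0 (2 * π)) {x : ℝ} {l : Filter ℝ}
    [l.IsCountablyGenerated] (hl : l ≤ 𝓝 x) {g : ℝ → ℝ}
    (hg : ∀ a, Tendsto (fun y => ((⌊(y - a) / (2 * π)⌋ : ℤ) : ℝ)) l (𝓝 (g a))) :
    Tendsto (fun y => ∫ a, ((⌊(y - a) / (2 * π)⌋ : ℤ) : ℝ) ∂m) l (𝓝 (∫ a, g a ∂m)) := by
  have hp := two_pi_pos
  refine tendsto_integral_filter_of_dominated_convergence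
    (fun a => (|x| + 1 + |a|) / (2 * π) + 1)
    (Eventually.of_forall fun y => (integrable_floor_of_mem_Ico hm y).aestronglyMeasurable) ?_
    ((((integrable_const _).add (integrable_id_of_mem_Ico hm).abs).div_const _).add
      (integrable_const _)) (ae_of_all _ hg)
  filter_upwards [hl (Metric.ball_mem_nhds x one_pos)] with y hy
  refine ae_of_all _ fun a => (abs_floor_le _).trans ?_
  rw [abs_div, abs_of_pos hp]
  gcongr
  rw [Metric.mem_ball, Real.dist_eq] at hy
  calc |y - a| ≤ |y| + |a| := abs_sub _ _
    _ ≤ |x| + 1 + |a| := by linarith [abs_sub_abs_le_abs_sub y x]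

/-- The periodic cdf is the left limit of its right-continuous version. -/
lemma tendsto_rcdf_left (hm : ∀ᵐ a ∂m, a ∈ Ico 0 (2 * π)) (x : ℝ) :
    Tendsto (rcdf m) (𝓝[<] x) (𝓝 (cdf m x)) := by
  have hp := two_pi_pos
  have hlim := (tendsto_integral_floor hm (x := x) (l := 𝓝[<] x) nhdsWithin_le_nhds
    (g := fun a => ((⌈(x - a) / (2 * π)⌉ - 1 : ℤ) : ℝ)) fun a => ?_).add_const 1
  · have hi : Integrable (fun a => ((⌈(x - a) / (2 * π)⌉ : ℤ) : ℝ)) m := by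
      convert (integrable_floor_sub_div (measurable_neg (G := ℝ))
        (integrable_id_of_mem_Ico hm).neg (-x) (2 * π)).neg using 2 with a
      rw [Pi.neg_apply, ← Int.cast_neg, ← Int.ceil_neg]
      congr 2
      ring
    have hval : ∫ a, ((⌈(x - a) / (2 * π)⌉ - 1 : ℤ) : ℝ) ∂m + 1 = cdf m x := by
      push_cast
      rw [cdf_eq_integral_ceil hm, integral_sub hi (integrable_const _)]
      simp
    rwa [hval] at hlim
  · have ht : Tendsto (fun y => (y - a) / (2 * π)) (𝓝[<] x) (𝓝[<] ((x - a) / (2 * π))) := by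
      refine tendsto_nhdsWithin_iff.2 ⟨?_, ?_⟩
      · exact ((by fun_prop : Continuous fun y : ℝ => (y - a) / (2 * π)).tendsto x).mono_left
          nhdsWithin_le_nhds
      · filter_upwards [self_mem_nhdsWithin] with y hy
        exact div_lt_div_of_pos_right (sub_lt_sub_right hy a) hp
    exact (tendsto_pure_nhds (fun k : ℤ => (k : ℝ)) _).comp
      ((tendsto_floor_left_pure_ceil_sub_one _).comp ht)

lemma tendsto_rcdf_right (hm : ∀ᵐ a ∂m, a ∈ Ico 0 (2 * π)) (x : ℝ) :
    Tendsto (rcdf m) (𝓝[>] x) (𝓝 (rcdf m x)) := by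
  have hp := two_pi_pos
  refine (tendsto_integral_floor hm nhdsWithin_le_nhds fun a => ?_).add_const 1
  have ht : Tendsto (fun y => (y - a) / (2 * π)) (𝓝[>] x) (𝓝[≥] ((x - a) / (2 * π))) := by
    refine tendsto_nhdsWithin_iff.2 ⟨?_, ?_⟩
    · exact ((by fun_prop : Continuous fun y : ℝ => (y - a) / (2 * π)).tendsto x).mono_left
        nhdsWithin_le_nhds
    · filter_upwards [self_mem_nhdsWithin] with y hy
      exact div_le_div_of_nonneg_right (sub_le_sub_right (le_of_lt hy) a) hp.le
  exact (tendsto_pure_nhds (fun k : ℤ => (k : ℝ)) _).comp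
    ((tendsto_floor_right_pure_floor _).comp ht)

lemma rcdf_mono (hm : ∀ᵐ a ∂m, a ∈ Ico 0 (2 * π)) : Monotone (rcdf m) := fun x y hxy => by
  refine add_le_add_left (integral_mono (integrable_floor_of_mem_Ico hm x)
    (integrable_floor_of_mem_Ico hm y) fun a => ?_) 1
  have := two_pi_pos
  exact Int.cast_le.2 (Int.floor_le_floor (by gcongr))

lemma cdf_le_rcdf (hm : ∀ᵐ a ∂m, a ∈ Ico 0 (2 * π)) (x : ℝ) : cdf m x ≤ rcdf m x :=
  le_of_tendsto (tendsto_rcdf_left hm x) <| by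
    filter_upwards [self_mem_nhdsWithin] with y hy using rcdf_mono hm (le_of_lt hy)

lemma rcdf_le_cdf_of_lt (hm : ∀ᵐ a ∂m, a ∈ Ico 0 (2 * π)) {x y : ℝ} (h : x < y) :
    rcdf m x ≤ cdf m y :=
  ge_of_tendsto (tendsto_rcdf_left hm y) <| by
    filter_upwards [Ioo_mem_nhdsLT h] with z hz using rcdf_mono hm hz.1.le

lemma cdf_mono (hm : ∀ᵐ a ∂m, a ∈ Ico 0 (2 * π)) : Monotone (cdf m) := fun x y h => by
  rcases h.eq_or_lt with rfl | h
  · rfl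
  · exact (cdf_le_rcdf hm x).trans (rcdf_le_cdf_of_lt hm h)

lemma rcdf_add_int_mul (hm : ∀ᵐ a ∂m, a ∈ Ico 0 (2 * π)) (x : ℝ) (k : ℤ) :
    rcdf m (x + k * (2 * π)) = rcdf m x + k := by
  have h : ∀ a, (x + k * (2 * π) - a) / (2 * π) = (x - a) / (2 * π) + k := fun a => by
    have := two_pi_pos
    field_simp
    ring
  simp only [rcdf, h, Int.floor_add_intCast, Int.cast_add]
  rw [integral_add (integrable_floor_of_mem_Ico hm x) (integrable_const _)]
  simp
  ring

lemma qf_le_iff (hm : ∀ᵐ a ∂m, a ∈ Ico 0 (2 * π)) {u x : ℝ} : qf m u ≤ x ↔ u ≤ rcdf m x := by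
  have hne : {x | u ≤ cdf m x}.Nonempty :=
    ⟨⌈u⌉ * (2 * π), by simpa [cdf_int_mul] using Int.le_ceil u⟩
  have hbd : BddBelow {x | u ≤ cdf m x} := by
    refine ⟨(⌈u⌉ - 1 : ℤ) * (2 * π), fun y (hy : u ≤ cdf m y) => ?_⟩
    by_contra! h
    have h1 := hy.trans (cdf_mono hm h.le)
    rw [cdf_int_mul] at h1
    push_cast at h1
    linarith [Int.ceil_lt_add_one u]
  constructor
  · intro h
    refine ge_of_tendsto (tendsto_rcdf_right hm x) ?_
    filter_upwards [self_mem_nhdsWithin] with y hy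
    obtain ⟨z, hz, hzy⟩ := exists_lt_of_csInf_lt hne (lt_of_le_of_lt h hy)
    exact le_trans (show u ≤ cdf m z from hz)
      ((cdf_mono hm hzy.le).trans (cdf_le_rcdf hm y))
  · intro h
    refine le_of_forall_gt_imp_ge_of_dense fun y hy => ?_
    exact csInf_le hbd (h.trans (rcdf_le_cdf_of_lt hm hy))

lemma qf_mono (hm : ∀ᵐ a ∂m, a ∈ Ico 0 (2 * π)) : Monotone (qf m) := fun _ _ h =>
  (qf_le_iff hm).2 (h.trans ((qf_le_iff hm).1 le_rfl))

lemma qf_add_int (hm : ∀ᵐ a ∂m, a ∈ Ico 0 (2 * π)) (u : ℝ) (k : ℤ) :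
    qf m (u + k) = qf m u + k * (2 * π) := by
  refine eq_of_forall_ge_iff fun x => ?_
  have h := rcdf_add_int_mul hm x (-k)
  push_cast at h
  rw [qf_le_iff hm, ← le_sub_iff_add_le (a := qf m u), qf_le_iff hm, sub_eq_add_neg, ← neg_mul, h,
    ← sub_eq_add_neg, le_sub_iff_add_le]

lemma floor_sub_qf (hm : ∀ᵐ a ∂m, a ∈ Ico 0 (2 * π)) (t u : ℝ) :
    ⌊(t - qf m u) / (2 * π)⌋ = ⌊rcdf m t - u⌋ := by
  refine eq_of_forall_le_iff fun k => ?_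
  rw [Int.le_floor, Int.le_floor, le_div_iff₀ two_pi_pos, le_sub_iff_add_le, le_sub_iff_add_le,
    add_comm, ← qf_add_int hm, qf_le_iff hm, add_comm]

lemma cdf_eq_rcdf (hm : ∀ᵐ a ∂m, a ∈ Ico 0 (2 * π)) (h0 : ∀ x, m {x} = 0) (x : ℝ) :
    cdf m x = rcdf m x := by
  have hc : m (range fun k : ℤ => x - k * (2 * π)) = 0 :=
    have : NullSingletonClass m := ⟨h0⟩
    (countable_range _).measure_zero m
  have h : (fun a => ((⌈(x - a) / (2 * π)⌉ : ℤ) : ℝ)) =ᵐ[m]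
      fun a => ((⌊(x - a) / (2 * π)⌋ : ℤ) : ℝ) + 1 := by
    filter_upwards [measure_eq_zero_iff_ae_notMem.1 hc] with a ha
    have : ⌈(x - a) / (2 * π)⌉ = ⌊(x - a) / (2 * π)⌋ + 1 := by
      refine Int.ceil_eq_floor_add_one_iff_notMem _ |>.2 ?_
      rintro ⟨k, hk⟩
      refine ha ⟨k, ?_⟩
      have := two_pi_pos
      rw [eq_div_iff this.ne'] at hk
      simp only
      linarith
    rw [this]; push_cast; rfl
  rw [cdf_eq_integral_ceil hm, integral_congr_ae h, integral_add (integrable_floor_of_mem_Ico hm x)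
    (integrable_const _), rcdf]
  simp

lemma cdf_qf (hm : ∀ᵐ a ∂m, a ∈ Ico 0 (2 * π)) (h0 : ∀ x, m {x} = 0) (u : ℝ) :
    cdf m (qf m u) = u := by
  refine le_antisymm (le_of_tendsto (tendsto_rcdf_left hm _) ?_) ?_
  · filter_upwards [self_mem_nhdsWithin] with y hy
    exact (not_le.1 fun h => (not_le.2 hy) ((qf_le_iff hm).2 h)).le
  · rw [cdf_eq_rcdf hm h0]
    exact (qf_le_iff hm).1 le_rfl

/-- The quantile function pushes the uniform law on `(0, 1]` to the measure. -/
lemma map_qf (hm : ∀ᵐ a ∂m, a ∈ Ico 0 (2 * π)) :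
    (volume.restrict (Ioc (0:ℝ) 1)).map (qf m) = m := by
  have hq := (qf_mono hm).measurable
  have : IsProbabilityMeasure (volume.restrict (Ioc (0:ℝ) 1)) := ⟨by simp⟩
  have := Measure.isProbabilityMeasure_map (μ := volume.restrict (Ioc (0:ℝ) 1)) hq.aemeasurable
  refine Measure.ext_of_Iic _ _ fun x => ?_
  rw [Measure.map_apply hq measurableSet_Iic, Measure.restrict_apply (hq measurableSet_Iic)]
  have hs : qf m ⁻¹' Iic x ∩ Ioc 0 1 = Ioc 0 (min (rcdf m x) 1) := by
    ext u
    simp only [mem_inter_iff, mem_preimage, mem_Iic, qf_le_iff hm, mem_Ioc, le_min_iff]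
    tauto
  rw [hs, Real.volume_Ioc, sub_zero]
  have hp := two_pi_pos
  rcases lt_or_ge x 0 with hx | hx
  · have h1 : rcdf m x ≤ 0 := by simpa [cdf_zero] using rcdf_le_cdf_of_lt hm hx
    rw [ENNReal.ofReal_of_nonpos (min_le_of_left_le h1), eq_comm, measure_eq_zero_iff_ae_notMem]
    filter_upwards [hm] with a ha h
    exact absurd (hx.trans_le ha.1) (not_lt.2 h)
  rcases lt_or_ge x (2 * π) with hx2 | hx2
  · have h1 : rcdf m x ≤ 1 := by
      simpa using (rcdf_le_cdf_of_lt hm hx2).trans_eq (by simpa using cdf_int_mul m 1)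
    rw [min_eq_left h1]
    have h : (fun a => ((⌊(x - a) / (2 * π)⌋ : ℤ) : ℝ)) =ᵐ[m]
        fun a => (Iic x).indicator (fun _ => (1:ℝ)) a - 1 := by
      filter_upwards [hm] with a ha
      by_cases hax : a ≤ x
      · rw [indicator_of_mem (show a ∈ Iic x from hax)]
        have : ⌊(x - a) / (2 * π)⌋ = 0 := by
          rw [Int.floor_eq_iff]
          constructor
          · push_cast; exact div_nonneg (by linarith) hp.le
          · push_cast; rw [div_lt_iff₀ hp]; linarith [ha.1]
        simp [this]
      · rw [indicator_of_notMem (show a ∉ Iic x from hax)]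
        have : ⌊(x - a) / (2 * π)⌋ = -1 := by
          rw [Int.floor_eq_iff]
          constructor
          · push_cast; rw [le_div_iff₀ hp]; linarith [ha.2]
          · push_cast; rw [div_lt_iff₀ hp]; linarith
        simp [this]
    rw [rcdf, integral_congr_ae h, integral_sub ((integrable_const _).indicator measurableSet_Iic)
      (integrable_const _), integral_indicator measurableSet_Iic]
    simp [Measure.real]
  · have h1 : 1 ≤ rcdf m x := by
      have := (cdf_le_rcdf hm (2 * π)).trans (rcdf_mono hm hx2)
      rwa [show cdf m (2 * π) = 1 by simpa using cdf_int_mul m 1] at this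
    rw [min_eq_right h1, ENNReal.ofReal_one, eq_comm, prob_compl_eq_zero_iff measurableSet_Iic |>.1]
    rw [measure_eq_zero_iff_ae_notMem]
    filter_upwards [hm] with a ha h
    exact h (ha.2.le.trans hx2)

end Quantile

section Circle

lemma measurable_logc : Measurable logc :=
  measurable_subtype_coe.comp (AddCircle.measurableEquivIco (2 * π) 0).measurable

lemma measurable_expc : Measurable expc := AddCircle.measurable_mk'

lemma logc_mem_Ico (z : S1) : logc z ∈ Ico 0 (2 * π) := by
  simpa [logc] using (AddCircle.equivIco (2 * π) 0 z).2

lemma expc_logc (z : S1) : expc (logc z) = z := AddCircle.coe_equivIco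

lemma expc_add_int_mul (x : ℝ) (k : ℤ) : expc (x + k * (2 * π)) = expc x := by
  have h : ((k * (2 * π) : ℝ) : S1) = 0 := AddCircle.coe_eq_zero_iff _ |>.2 ⟨k, by simp⟩
  rw [expc, expc, AddCircle.coe_add, h, add_zero]

lemma exists_logc_expc (x : ℝ) : ∃ k : ℤ, logc (expc x) = x + k * (2 * π) := by
  have h : ((logc (expc x) - x : ℝ) : S1) = 0 := by
    rw [AddCircle.coe_sub, sub_eq_zero]
    exact expc_logc (expc x)
  obtain ⟨k, hk⟩ := (AddCircle.coe_eq_zero_iff _).1 h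
  exact ⟨k, by rw [zsmul_eq_mul] at hk; linarith⟩

lemma dist_expc (x y : ℝ) :
    dist (expc x) (expc y) = |x - y - round ((2 * π)⁻¹ * (x - y)) * (2 * π)| := by
  rw [dist_eq_norm, expc, expc, ← AddCircle.coe_sub, AddCircle.norm_eq]

lemma dist_expc_le (x y : ℝ) : dist (expc x) (expc y) ≤ |x - y| := by
  rw [dist_expc]
  have hp := two_pi_pos
  have h := round_le ((2 * π)⁻¹ * (x - y)) 0
  have e : x - y - round ((2 * π)⁻¹ * (x - y)) * (2 * π) =
      ((2 * π)⁻¹ * (x - y) - round ((2 * π)⁻¹ * (x - y))) * (2 * π) := by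
    field_simp
  calc _ = |(2 * π)⁻¹ * (x - y) - round ((2 * π)⁻¹ * (x - y))| * (2 * π) := by
        rw [e, abs_mul, abs_of_pos hp]
    _ ≤ |(2 * π)⁻¹ * (x - y) - (0 : ℤ)| * (2 * π) := by gcongr
    _ = |x - y| := by
        rw [Int.cast_zero, sub_zero, abs_mul, abs_of_pos (inv_pos.2 hp)]
        field_simp

lemma dist_S1_le (z w : S1) : dist z w ≤ π := by
  rw [dist_eq_norm]
  refine (AddCircle.norm_le_half_period _ two_pi_pos.ne').trans_eq ?_
  rw [abs_of_pos two_pi_pos]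
  ring

variable (μ : Measure S1)

instance [IsProbabilityMeasure μ] : IsProbabilityMeasure (tilde μ) :=
  Measure.isProbabilityMeasure_map measurable_logc.aemeasurable

lemma tilde_ae_mem : ∀ᵐ a ∂(tilde μ), a ∈ Ico 0 (2 * π) :=
  (ae_map_iff measurable_logc.aemeasurable measurableSet_Ico).2 (ae_of_all _ logc_mem_Ico)

lemma map_expc_tilde : (tilde μ).map expc = μ := by
  rw [tilde, Measure.map_map measurable_expc measurable_logc]
  convert Measure.map_id using 2
  exact funext expc_logc

lemma tilde_singleton {μ : Measure S1} (hac : μ ≪ volume) (x : ℝ) : tilde μ {x} = 0 := by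
  rw [tilde, Measure.map_apply measurable_logc (measurableSet_singleton x)]
  refine hac (measure_mono_null (t := Metric.closedBall (expc x) 0) (fun z hz => ?_) ?_)
  · rw [Metric.closedBall_zero, mem_singleton_iff, ← expc_logc z]
    exact congrArg expc hz
  · rw [AddCircle.volume_closedBall]
    simp

/-- The curve `expc ∘ qf` over any unit interval parametrises the measure. -/
lemma map_expc_qf_sub [IsProbabilityMeasure μ] (θ : ℝ) :
    (volume.restrict (Ioc (0:ℝ) 1)).map (fun u => expc (qf (tilde μ) (u - θ))) = μ := by
  have hq := (qf_mono (tilde_ae_mem μ)).measurable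
  have hZ : Measurable fun u => expc (qf (tilde μ) u) := measurable_expc.comp hq
  have hZ' : Measurable fun u => expc (qf (tilde μ) (u - θ)) :=
    hZ.comp (measurable_id.sub_const θ)
  have h0 : (volume.restrict (Ioc (0:ℝ) 1)).map (fun u => expc (qf (tilde μ) u)) = μ := by
    conv_rhs => rw [← map_expc_tilde μ, ← map_qf (tilde_ae_mem μ)]
    exact (Measure.map_map measurable_expc hq).symm
  ext A hA
  conv_rhs => rw [← h0]
  have hB := hZ hA
  rw [Measure.map_apply hZ' hA, Measure.map_apply hZ hA,
    Measure.restrict_apply (hZ' hA), Measure.restrict_apply hB]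
  set B := (fun u => expc (qf (tilde μ) u)) ⁻¹' A
  have h1 : (fun u => expc (qf (tilde μ) (u - θ))) ⁻¹' A ∩ Ioc 0 1 =
      (fun u => u - θ) ⁻¹' (B ∩ Ioc (-θ) (-θ + 1)) := by
    ext u
    simp only [mem_inter_iff, mem_preimage, mem_Ioc, B]
    constructor <;> rintro ⟨h, h1, h2⟩ <;> exact ⟨h, by linarith, by linarith⟩
  refine (congrArg volume h1).trans ?_
  rw [(measurePreserving_sub_right volume θ).measure_preimage
    (hB.inter measurableSet_Ioc).nullMeasurableSet]
  have h2 := (isAddFundamentalDomain_Ioc one_pos (-θ)).measure_set_eq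
    (isAddFundamentalDomain_Ioc (one_pos (α := ℝ)) 0) hB ?_
  · rwa [zero_add] at h2
  · rintro ⟨g, k, rfl⟩
    ext u
    have : expc (qf (tilde μ) (u + k)) = expc (qf (tilde μ) u) := by
      rw [qf_add_int (tilde_ae_mem μ), expc_add_int_mul]
    simp only [B, mem_preimage, AddSubgroup.vadd_def, vadd_eq_add, zsmul_eq_mul, mul_one]
    rw [add_comm, this]

end Circle

section Transport

lemma cost_eq_setIntegral (μ ν : Measure S1) (θ : ℝ) :
    cost μ ν θ = ∫ u in Ioc (0:ℝ) 1, (qf (tilde μ) u - qf (tilde ν) (u - θ)) ^ 2 :=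
  intervalIntegral.integral_of_le zero_le_one

variable (μ ν : Measure S1) [IsProbabilityMeasure μ] [IsProbabilityMeasure ν]

lemma integrableOn_cost (θ : ℝ) :
    IntegrableOn (fun u => (qf (tilde μ) u - qf (tilde ν) (u - θ)) ^ 2) (Ioc 0 1) := by
  have hq := qf_mono (tilde_ae_mem μ)
  have hr := qf_mono (tilde_ae_mem ν)
  have hm : Measurable fun u => (qf (tilde μ) u - qf (tilde ν) (u - θ)) ^ 2 :=
    (hq.measurable.sub (hr.measurable.comp (measurable_id.sub_const θ))).pow_const 2
  set A := qf (tilde μ) 0 - qf (tilde ν) (1 - θ)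
  set B := qf (tilde μ) 1 - qf (tilde ν) (0 - θ)
  refine Integrable.of_bound hm.aestronglyMeasurable (A ^ 2 + B ^ 2) ?_
  filter_upwards [ae_restrict_mem measurableSet_Ioc] with u hu
  have h1 : A ≤ qf (tilde μ) u - qf (tilde ν) (u - θ) :=
    sub_le_sub (hq hu.1.le) (hr (by linarith [hu.2]))
  have h2 : qf (tilde μ) u - qf (tilde ν) (u - θ) ≤ B :=
    sub_le_sub (hq hu.2) (hr (by linarith [hu.1]))
  rw [Real.norm_eq_abs, abs_of_nonneg (sq_nonneg _)]
  rcases le_total 0 (qf (tilde μ) u - qf (tilde ν) (u - θ)) with h | h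
  · nlinarith
  · nlinarith

/-- Every coupling costs at least as much as the monotone coupling with a suitable shift. -/
lemma exists_cost_le {γ : Measure (S1 × S1)} [IsProbabilityMeasure γ]
    (h1 : γ.map Prod.fst = μ) (h2 : γ.map Prod.snd = ν) :
    ∃ θ, cost μ ν θ ≤ ∫ p, dist p.1 p.2 ^ 2 ∂γ := by
  have hp := two_pi_pos
  have hμ := tilde_ae_mem μ
  have hν := tilde_ae_mem ν
  set X : S1 × S1 → ℝ := fun p => logc p.1
  set Y₀ : S1 × S1 → ℝ := fun p => logc p.2
  set k : S1 × S1 → ℤ := fun p => round ((2 * π)⁻¹ * (logc p.1 - logc p.2))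
  set Y : S1 × S1 → ℝ := fun p => Y₀ p + k p * (2 * π)
  have hX : Measurable X := measurable_logc.comp measurable_fst
  have hY₀ : Measurable Y₀ := measurable_logc.comp measurable_snd
  have hk : Measurable fun p => (k p : ℝ) := by
    have : k = fun p => ⌊(2 * π)⁻¹ * (X p - Y₀ p) + 1 / 2⌋ := funext fun p => round_eq _
    rw [this]
    exact measurable_from_top.comp ((((hX.sub hY₀).const_mul _).add_const _).floor)
  have hY : Measurable Y := hY₀.add (hk.mul_const _)
  have hki : Integrable (fun p => (k p : ℝ)) γ := by
    refine Integrable.of_bound hk.aestronglyMeasurable 2 (ae_of_all _ fun p => ?_)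
    have ha := logc_mem_Ico p.1
    have hb := logc_mem_Ico p.2
    have hr := abs_le.1 (abs_sub_round ((2 * π)⁻¹ * (logc p.1 - logc p.2)))
    have hv1 : (2 * π)⁻¹ * (logc p.1 - logc p.2) ≤ 1 := by
      rw [inv_mul_le_iff₀ hp]; linarith [ha.2, hb.1]
    have hv2 : -1 ≤ (2 * π)⁻¹ * (logc p.1 - logc p.2) := by
      rw [le_inv_mul_iff₀ hp]; linarith [ha.1, hb.2]
    rw [Real.norm_eq_abs, abs_le]
    constructor <;> simp only [k] <;> linarith [hr.1, hr.2]
  have hmapX : γ.map X = tilde μ := by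
    rw [tilde, ← h1, Measure.map_map measurable_logc measurable_fst]; rfl
  have hmapY : γ.map Y₀ = tilde ν := by
    rw [tilde, ← h2, Measure.map_map measurable_logc measurable_snd]; rfl
  have hmeas : ∀ s, Measurable fun a : ℝ => ((⌊(s - a) / (2 * π)⌋ : ℤ) : ℝ) := fun s =>
    measurable_floor_sub_div measurable_id measurable_const _
  have hXi : ∀ s, Integrable (fun p => ((⌊(s - X p) / (2 * π)⌋ : ℤ) : ℝ)) γ := fun s => by
    have := integrable_floor_of_mem_Ico hμ s
    rw [← hmapX] at this
    exact this.comp_measurable hX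
  have hY₀i : ∀ s, Integrable (fun p => ((⌊(s - Y₀ p) / (2 * π)⌋ : ℤ) : ℝ)) γ := fun s => by
    have := integrable_floor_of_mem_Ico hν s
    rw [← hmapY] at this
    exact this.comp_measurable hY₀
  have hfl : ∀ s p, ((⌊(s - Y p) / (2 * π)⌋ : ℤ) : ℝ) =
      ((⌊(s - Y₀ p) / (2 * π)⌋ : ℤ) : ℝ) - k p := fun s p => by
    have : (s - Y p) / (2 * π) = (s - Y₀ p) / (2 * π) - k p := by
      simp only [Y]; field_simp; ring
    rw [this, Int.floor_sub_intCast, Int.cast_sub]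
  have ha : ∀ s, ∫ p, ((⌊(s - X p) / (2 * π)⌋ : ℤ) : ℝ) ∂γ = rcdf (tilde μ) s - 1 := fun s => by
    rw [rcdf, ← hmapX, integral_map hX.aemeasurable (hmeas s).aestronglyMeasurable]
    ring
  set θ : ℝ := -∫ p, (k p : ℝ) ∂γ with hθ
  have hb : ∀ s, ∫ p, ((⌊(s - Y p) / (2 * π)⌋ : ℤ) : ℝ) ∂γ =
      (rcdf (tilde ν) s + θ) - 1 := fun s => by
    simp_rw [hfl]
    rw [integral_sub (hY₀i s) hki, rcdf, ← hmapY,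
      integral_map hY₀.aemeasurable (hmeas s).aestronglyMeasurable, hθ]
    ring
  have hdist : ∀ p : S1 × S1, dist p.1 p.2 ^ 2 = (X p - Y p) ^ 2 := fun p => by
    conv_lhs => rw [← expc_logc p.1, ← expc_logc p.2]
    rw [dist_expc, sq_abs]
    simp only [X, Y, Y₀, k]
    ring
  have hle := lintegral_sq_le γ hX hY hp (a := rcdf (tilde μ)) (b := fun s => rcdf (tilde ν) s + θ)
    hXi (fun s => by simp_rw [hfl]; exact (hY₀i s).sub hki) ha hb
    (X' := qf (tilde μ)) (Y' := fun u => qf (tilde ν) (u - θ)) (qf_mono hμ).measurable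
    ((qf_mono hν).measurable.comp (measurable_id.sub_const θ)) (floor_sub_qf hμ)
    (fun s u => by rw [floor_sub_qf hν]; congr 1; ring)
  refine ⟨θ, ?_⟩
  have hint : Integrable (fun p => (X p - Y p) ^ 2) γ := by
    refine Integrable.of_bound ((hX.sub hY).pow_const 2).aestronglyMeasurable (π ^ 2)
      (ae_of_all _ fun p => ?_)
    rw [Real.norm_eq_abs, abs_of_nonneg (sq_nonneg _), ← hdist]
    exact pow_le_pow_left₀ dist_nonneg (dist_S1_le _ _) 2
  simp_rw [hdist]
  rw [← ENNReal.ofReal_le_ofReal_iff (integral_nonneg fun p => sq_nonneg _), cost_eq_setIntegral,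
    ofReal_integral_eq_lintegral_ofReal (integrableOn_cost μ ν θ)
      (ae_of_all _ fun u => sq_nonneg _),
    ofReal_integral_eq_lintegral_ofReal hint (ae_of_all _ fun u => sq_nonneg _)]
  exact hle

end Transport

/-- The map `T = exp_c ∘ F_ν̃⁻(F_μ̃(·) − θ*) ∘ log_c`, where `θ*` minimises
`C_{[μ,ν]}`, pushes `μ` to `ν` and is an optimal transport map, and
`W₂²(μ,ν) = C_{[μ,ν]}(θ*) = min_θ C_{[μ,ν]}(θ)`. -/
theorem stmt0 (μ ν : Measure S1) [IsProbabilityMeasure μ] [IsProbabilityMeasure ν]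
    (hac : μ ≪ volume) (θs : ℝ)
    (hθs : ∀ θ : ℝ, cost μ ν θs ≤ cost μ ν θ)
    (Tt : ℝ → ℝ) (hTt : Tt = fun x => qf (tilde ν) (cdf (tilde μ) x - θs))
    (T : S1 → S1) (hT : T = fun z => expc (Tt (logc z))) :
    μ.map T = ν ∧ (∫ z, dist z (T z) ^ 2 ∂μ) = W2sq μ ν ∧ IsOTM μ ν T ∧
      W2sq μ ν = cost μ ν θs := by
  have hμ := tilde_ae_mem μ
  have hν := tilde_ae_mem ν
  have hq := (qf_mono hμ).measurable
  have hTm : Measurable T := by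
    rw [hT, hTt]
    exact measurable_expc.comp ((qf_mono hν).measurable.comp
      (((cdf_mono hμ).measurable.comp measurable_logc).sub_const θs))
  have hTq : ∀ u, T (expc (qf (tilde μ) u)) = expc (qf (tilde ν) (u - θs)) := fun u => by
    obtain ⟨k, hk⟩ := exists_logc_expc (qf (tilde μ) u)
    simp only [hT, hTt]
    rw [hk, cdf_add_int_mul, cdf_qf hμ (tilde_singleton hac), add_sub_right_comm, qf_add_int hν,
      expc_add_int_mul]
  have hZ : Measurable fun u => expc (qf (tilde μ) u) := measurable_expc.comp hq
  have hμZ : (volume.restrict (Ioc (0:ℝ) 1)).map (fun u => expc (qf (tilde μ) u)) = μ := by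
    simpa using map_expc_qf_sub μ 0
  have hpush : μ.map T = ν := by
    conv_lhs => rw [← hμZ]
    rw [Measure.map_map hTm hZ]
    refine Eq.trans ?_ (map_expc_qf_sub ν θs)
    congr 1
    exact funext hTq
  have hTle : ∫ z, dist z (T z) ^ 2 ∂μ ≤ cost μ ν θs := by
    have hdm : Measurable fun z => dist z (T z) ^ 2 := (measurable_id.dist hTm).pow_const 2
    conv_lhs => rw [← hμZ]
    rw [integral_map hZ.aemeasurable hdm.aestronglyMeasurable, cost_eq_setIntegral]
    refine integral_mono_of_nonneg (ae_of_all _ fun u => by positivity)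
      (integrableOn_cost μ ν θs) (ae_of_all _ fun u => ?_)
    simp only [hTq]
    rw [← sq_abs (qf (tilde μ) u - _)]
    exact pow_le_pow_left₀ dist_nonneg (dist_expc_le _ _) 2
  have hlow : ∀ c ∈ {c : ℝ | ∃ γ : Measure (S1 × S1), IsProbabilityMeasure γ ∧
      γ.map Prod.fst = μ ∧ γ.map Prod.snd = ν ∧ c = ∫ p, dist p.1 p.2 ^ 2 ∂γ},
      cost μ ν θs ≤ c := by
    rintro c ⟨γ, hγ, h1, h2, rfl⟩
    obtain ⟨θ, hθ⟩ := exists_cost_le μ ν h1 h2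
    exact (hθs θ).trans hθ
  have hgraph : Measurable fun z => (z, T z) := measurable_id.prodMk hTm
  have hmem : ∫ z, dist z (T z) ^ 2 ∂μ ∈ {c : ℝ | ∃ γ : Measure (S1 × S1),
      IsProbabilityMeasure γ ∧ γ.map Prod.fst = μ ∧ γ.map Prod.snd = ν ∧
      c = ∫ p, dist p.1 p.2 ^ 2 ∂γ} := by
    refine ⟨μ.map fun z => (z, T z), Measure.isProbabilityMeasure_map hgraph.aemeasurable,
      ?_, ?_, ?_⟩
    · rw [Measure.map_map measurable_fst hgraph]
      exact Measure.map_id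
    · rw [Measure.map_map measurable_snd hgraph]
      exact hpush
    · rw [integral_map hgraph.aemeasurable]
      exact ((measurable_fst.dist measurable_snd).pow_const 2).aestronglyMeasurable
  have hWle : W2sq μ ν ≤ ∫ z, dist z (T z) ^ 2 ∂μ := csInf_le ⟨_, hlow⟩ hmem
  have hleW : cost μ ν θs ≤ W2sq μ ν := le_csInf ⟨_, hmem⟩ hlow
  have hTW : ∫ z, dist z (T z) ^ 2 ∂μ = W2sq μ ν := le_antisymm (hTle.trans hleW) hWle
  exact ⟨hpush, hTW, ⟨hTm, hpush, hTW⟩, le_antisymm (hWle.trans hTle) hleW⟩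

end
end

section
/- Let μ be an absolutely continuous probability measure on S¹. The set of maps T̃ : ℝ → ℝ satisfying (i) T̃ monotone nondecreasing with T̃(x + 2π) = T̃(x) + 2π for all x ∈ ℝ, (ii) ∫₀^{2π}(T̃(u) − u) du = 0, and (iii) |T̃(x) − x| < π for μ̃-almost every x, is convex: if T̃₀ and T̃₁ both satisfy (i)–(iii) and t ∈ [0,1], then (1−t)·T̃₀ + t·T̃₁ also satisfies (i)–(iii). In particular the image of the logarithmic map log_μ is a convex set. -/
open MeasureTheory Real Set Filter Topology

noncomputable section

/-- A lift `T̃ : ℝ → ℝ` satisfying the three conditions (i)–(iii) characterising (lifts of)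
optimal transport maps from an a.c. measure `μ` on `S¹`. -/
def GoodLift (μ : Measure S1) (T : ℝ → ℝ) : Prop :=
  Monotone T ∧ (∀ x : ℝ, T (x + 2 * π) = T x + 2 * π) ∧
    (∫ u in (0:ℝ)..(2 * π), (T u - u)) = 0 ∧
    (∀ᵐ x ∂(tilde μ), |T x - x| < π)

/-- The set of maps satisfying (i)–(iii) is convex; in particular the image
of the logarithmic map `log_μ` is a convex set. -/
theorem stmt3 (μ : Measure S1) [IsProbabilityMeasure μ] (hac : μ ≪ volume)
    (T0 T1 : ℝ → ℝ) (h0 : GoodLift μ T0) (h1 : GoodLift μ T1)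
    (t : ℝ) (ht0 : 0 ≤ t) (ht1 : t ≤ 1) :
    GoodLift μ (fun x => (1 - t) * T0 x + t * T1 x) := by
  obtain ⟨m0, p0, i0, a0⟩ := h0
  obtain ⟨m1, p1, i1, a1⟩ := h1
  have ht0' : 0 ≤ 1 - t := sub_nonneg.2 ht1
  have int0 : IntervalIntegrable (fun u => T0 u - u) volume 0 (2 * π) :=
    m0.intervalIntegrable.sub (continuous_id.intervalIntegrable _ _)
  have int1 : IntervalIntegrable (fun u => T1 u - u) volume 0 (2 * π) :=
    m1.intervalIntegrable.sub (continuous_id.intervalIntegrable _ _)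
  have displacement (x : ℝ) : (1 - t) * T0 x + t * T1 x - x =
      (1 - t) * (T0 x - x) + t * (T1 x - x) := by ring
  refine ⟨(m0.const_mul ht0').add (m1.const_mul ht0), fun x => ?_, ?_, ?_⟩
  · simp only [p0, p1]
    ring
  · simp only [displacement]
    rw [intervalIntegral.integral_add (int0.const_mul _) (int1.const_mul _),
      intervalIntegral.integral_const_mul, intervalIntegral.integral_const_mul, i0, i1]
    simp
  · filter_upwards [a0, a1] with x b0 b1
    rw [displacement, ← Real.norm_eq_abs, ← mem_ball_zero_iff]
    exact convex_ball (0 : ℝ) π (mem_ball_zero_iff.2 b0) (mem_ball_zero_iff.2 b1) ht0' ht0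
      (sub_add_cancel 1 t)

end
end
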